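/- Let (X,d,μ) be a space of homogeneous type, p ∈ [1,∞), ω ∈ A_p(μ), and b ∈ BMO(μ). Then there exists a constant C > 0 such that for every ball B ⊆ X, (∫_B |b(x) − b_B|^p ω(x) dμ(x))^{1/p} ≤ C·‖b‖_{BMO(μ)}·ω(B)^{1/p}. -/

import Mathlib

open MeasureTheory Metric ENNReal

/-- The Muckenhoupt class `A_p(μ)` on a metric measure space, `p ∈ [1,∞)`:
for `p = 1` the usual `A_1` condition with the essential infimum, and for `p > 1`
the product condition with the conjugate exponent `p' = p/(p-1)`. -/
def IsAp {X : Type*} [MetricSpace X] [MeasurableSpace X]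
    (μ : Measure X) (ω : X → ℝ≥0∞) (p : ℝ) : Prop :=
  if p = 1 then
    ∃ A : ℝ≥0∞, A ≠ ⊤ ∧ ∀ (x : X) (r : ℝ), 0 < r →
      ∫⁻ y in ball x r, ω y ∂μ ≤
        A * μ (ball x r) * essInf ω (μ.restrict (ball x r))
  else
    ∃ A : ℝ≥0∞, A ≠ ⊤ ∧ ∀ (x : X) (r : ℝ), 0 < r →
      ((μ (ball x r))⁻¹ * ∫⁻ y in ball x r, ω y ∂μ) *
        ((μ (ball x r))⁻¹ * ∫⁻ y in ball x r, ω y ^ (1 - p / (p - 1)) ∂μ) ^ (p - 1) ≤ A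

theorem sigmaFinite_of_measure_ball_ne_top {X : Type*} [PseudoMetricSpace X] [MeasurableSpace X]
    {μ : Measure X} (h : ∀ (x : X) (r : ℝ), μ (ball x r) ≠ ⊤) : SigmaFinite μ := by
  rcases isEmpty_or_nonempty X with hX | ⟨⟨x₀⟩⟩
  · rw [Measure.eq_zero_of_isEmpty μ]
    infer_instance
  · exact ⟨⟨{ set := fun n => ball x₀ n
              set_mem := fun _ => trivial
              finite := fun n => (h x₀ n).lt_top
              spanning := iUnion_ball_nat x₀ }⟩⟩

theorem secondCountableTopology_of_measure_ball {X : Type*} [PseudoMetricSpace X]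
    [MeasurableSpace X] [OpensMeasurableSpace X] {μ : Measure X}
    (hpos : ∀ (x : X) (r : ℝ), 0 < r → μ (ball x r) ≠ 0)
    (hfin : ∀ (x : X) (r : ℝ), μ (ball x r) ≠ ⊤) : SecondCountableTopology X := by
  have := sigmaFinite_of_measure_ball_ne_top hfin
  refine Metric.secondCountable_of_almost_dense_set fun ε hε => ?_
  obtain ⟨u, -, hdisj, hcov⟩ := Vitali.exists_disjoint_subfamily_covering_enlargement_closedBall
    (Set.univ : Set X) id (fun _ => ε / 5) (ε / 5) (fun _ _ => le_rfl) 5 (by norm_num)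
  refine ⟨u, ?_, fun x => ?_⟩
  · have hc := Measure.countable_meas_pos_of_disjoint_iUnion (μ := μ)
      (As := fun a : u => closedBall (a : X) (ε / 5))
      (fun _ => isClosed_closedBall.measurableSet)
      (fun a b hab => hdisj a.2 b.2 (fun h => hab (Subtype.ext h)))
    have huniv : {a : u | 0 < μ (closedBall (a : X) (ε / 5))} = Set.univ := by
      refine Set.eq_univ_of_forall fun a => ?_
      exact (pos_iff_ne_zero.2 (hpos a (ε / 5) (by positivity))).trans_le
        (measure_mono ball_subset_closedBall)
    rw [huniv] at hc
    exact Set.countable_coe_iff.1 (Set.countable_univ_iff.1 hc)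
  · obtain ⟨y, hy, hxy⟩ := hcov x (Set.mem_univ x)
    have hx := hxy (mem_closedBall_self (by positivity))
    refine ⟨y, hy, ?_⟩
    simpa [mem_closedBall, mul_div_cancel₀] using hx

/-- Every set occupying a fixed proportion of a ball carries a fixed proportion of the
`A_p` weight of that ball. -/
theorem IsAp.withDensity_ball_le {X : Type*} [MetricSpace X] [MeasurableSpace X] [BorelSpace X]
    {μ : Measure X} (hball : ∀ (x : X) (r : ℝ), 0 < r → μ (ball x r) ≠ 0 ∧ μ (ball x r) ≠ ⊤)
    {p : ℝ} (hp : 1 ≤ p) {ω : X → ℝ≥0∞} (hωm : Measurable ω) (hAp : IsAp μ ω p)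
    (c : ℝ≥0∞) (hc : c ≠ ⊤) :
    ∃ D : ℝ≥0∞, D ≠ ⊤ ∧ ∀ (x : X) (r : ℝ), 0 < r → ∀ F : Set X, MeasurableSet F →
      F ⊆ ball x r → μ (ball x r) ≤ c * μ F →
      μ.withDensity ω (ball x r) ≤ D * μ.withDensity ω F := by
  rcases hp.eq_or_lt with rfl | hp1
  · rw [IsAp, if_pos rfl] at hAp
    obtain ⟨A, hA, h⟩ := hAp
    refine ⟨A * c, mul_ne_top hA hc, fun x r hr F hF hFB hμ => ?_⟩
    rw [withDensity_apply _ measurableSet_ball, withDensity_apply _ hF]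
    have hess : essInf ω (μ.restrict (ball x r)) * μ F ≤ ∫⁻ y in F, ω y ∂μ := by
      rw [← setLIntegral_const]
      exact lintegral_mono_ae (ae_restrict_of_ae_restrict_of_subset hFB ae_essInf_le)
    calc ∫⁻ y in ball x r, ω y ∂μ
        ≤ A * μ (ball x r) * essInf ω (μ.restrict (ball x r)) := h x r hr
      _ ≤ A * (c * μ F) * essInf ω (μ.restrict (ball x r)) := by gcongr
      _ = A * c * (essInf ω (μ.restrict (ball x r)) * μ F) := by ring
      _ ≤ A * c * ∫⁻ y in F, ω y ∂μ := by gcongr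
  · rw [IsAp, if_neg hp1.ne'] at hAp
    obtain ⟨A, hA, h⟩ := hAp
    have hp0 : 0 < p := by linarith
    have hp10 : 0 < p - 1 := by linarith
    refine ⟨A * c ^ p + 1,
      add_ne_top.2 ⟨mul_ne_top hA (rpow_ne_top_of_nonneg hp0.le hc), one_ne_top⟩,
      fun x r hr F hF hFB hμ => ?_⟩
    obtain ⟨hm0, hmT⟩ := hball x r hr
    have hF0 : μ F ≠ 0 := by
      rintro h0
      rw [h0, mul_zero] at hμ
      exact hm0 (le_zero_iff.1 hμ)
    have hFT : μ F ≠ ⊤ := ne_top_of_le_ne_top hmT (measure_mono hFB)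
    rw [withDensity_apply _ measurableSet_ball, withDensity_apply _ hF]
    have hexp : 1 - p / (p - 1) = -(1 / (p - 1)) := by field_simp; ring
    specialize h x r hr
    rw [hexp] at h
    set W := ∫⁻ y in ball x r, ω y ∂μ with hW
    set S := ∫⁻ y in ball x r, ω y ^ (-(1 / (p - 1))) ∂μ with hS
    have hne : -(1 / (p - 1)) < 0 := by
      have : 0 < 1 / (p - 1) := by positivity
      linarith
    have hσm : Measurable fun y => ω y ^ (-(1 / (p - 1))) := hωm.pow_const _
    have hWS : W * S ^ (p - 1) ≤ A * μ (ball x r) ^ p := by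
      have e : W * S ^ (p - 1) = ((μ (ball x r))⁻¹ * W) * ((μ (ball x r))⁻¹ * S) ^ (p - 1)
          * μ (ball x r) ^ p := by
        rw [ENNReal.mul_rpow_of_nonneg _ _ hp10.le]
        have h1 : μ (ball x r) ^ p = μ (ball x r) * μ (ball x r) ^ (p - 1) := by
          conv_rhs => rw [← ENNReal.rpow_one (μ (ball x r)), ← ENNReal.rpow_mul, one_mul]
          rw [← ENNReal.rpow_add _ _ hm0 hmT]
          congr 1; ring
        have h2 : (μ (ball x r))⁻¹ * μ (ball x r) = 1 := ENNReal.inv_mul_cancel hm0 hmT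
        have h3 : (μ (ball x r))⁻¹ ^ (p - 1) * μ (ball x r) ^ (p - 1) = 1 := by
          rw [← ENNReal.mul_rpow_of_nonneg _ _ hp10.le, h2, ENNReal.one_rpow]
        rw [h1]
        calc W * S ^ (p - 1) = ((μ (ball x r))⁻¹ * μ (ball x r)) *
              ((μ (ball x r))⁻¹ ^ (p - 1) * μ (ball x r) ^ (p - 1)) * (W * S ^ (p - 1)) := by
              rw [h2, h3]; simp
          _ = _ := by ring
      rw [e]
      gcongr
    by_cases hW0 : W = 0
    · simp [hW0]
    by_cases hS0 : S = 0
    · have htop : ∀ᵐ y ∂μ.restrict F, ω y = ⊤ := by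
        refine ae_restrict_of_ae_restrict_of_subset hFB ?_
        filter_upwards [(lintegral_eq_zero_iff hσm).1 hS0] with y hy
        by_contra hne'
        have := (ENNReal.rpow_eq_zero_iff.1 hy)
        rcases this with ⟨-, h2⟩ | ⟨h2, -⟩
        · linarith
        · exact hne' h2
      have h_integral : ∫⁻ y in F, ω y ∂μ = ⊤ := by
        rw [lintegral_congr_ae htop, setLIntegral_const, ENNReal.top_mul hF0]
      rw [h_integral, ENNReal.mul_top (by simp)]
      exact le_top
    have hWST : W * S ^ (p - 1) ≠ ⊤ :=
      ne_top_of_le_ne_top (mul_ne_top hA (rpow_ne_top_of_nonneg hp0.le hmT)) hWS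
    have hWT : W ≠ ⊤ := by
      rintro hT
      rw [hT] at hWST
      have : S ^ (p - 1) = 0 := by
        by_contra h0
        exact hWST (ENNReal.top_mul h0)
      rcases ENNReal.rpow_eq_zero_iff.1 this with ⟨h1, -⟩ | ⟨-, h1⟩
      · exact hS0 h1
      · linarith
    have hST : S ≠ ⊤ := by
      rintro hT
      rw [hT, ENNReal.top_rpow_of_pos hp10, ENNReal.mul_top hW0] at hWST
      exact hWST rfl
    have hfin : ∀ᵐ y ∂μ.restrict F, ω y < ⊤ :=
      ae_restrict_of_ae_restrict_of_subset hFB (ae_lt_top hωm hWT)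
    have hpos : ∀ᵐ y ∂μ.restrict F, ω y ≠ 0 := by
      refine ae_restrict_of_ae_restrict_of_subset hFB ?_
      filter_upwards [ae_lt_top hσm hST] with y hy h0
      rw [h0, ENNReal.zero_rpow_of_neg hne] at hy
      exact lt_irrefl _ hy
    have hq : p.HolderConjugate (p / (p - 1)) := Real.HolderConjugate.conjExponent hp1
    have hhol := ENNReal.lintegral_mul_le_Lp_mul_Lq (μ.restrict F) hq
      (f := fun y => ω y ^ (1 / p)) (g := fun y => ω y ^ (-(1 / p)))
      (hωm.pow_const _).aemeasurable (hωm.pow_const _).aemeasurable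
    have hleft : ∫⁻ y in F, ((fun y => ω y ^ (1 / p)) * (fun y => ω y ^ (-(1 / p)))) y ∂μ = μ F := by
      rw [← setLIntegral_one]
      refine lintegral_congr_ae ?_
      filter_upwards [hfin, hpos] with y h1 h2
      simp only [Pi.mul_apply]
      rw [← ENNReal.rpow_add _ _ h2 h1.ne]
      simp
    have e1 : ∀ y, (ω y ^ (1 / p)) ^ p = ω y := fun y => by
      rw [← ENNReal.rpow_mul, one_div_mul_cancel hp0.ne', ENNReal.rpow_one]
    have e2 : ∀ y, (ω y ^ (-(1 / p))) ^ (p / (p - 1)) = ω y ^ (-(1 / (p - 1))) := fun y => by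
      rw [← ENNReal.rpow_mul]
      congr 1
      field_simp
    rw [hleft] at hhol
    simp only [e1, e2] at hhol
    have hkey : μ F ^ p ≤ (∫⁻ y in F, ω y ∂μ) * S ^ (p - 1) := by
      calc μ F ^ p ≤ ((∫⁻ y in F, ω y ∂μ) ^ (1 / p) * S ^ (1 / (p / (p - 1)))) ^ p := by
            refine ENNReal.rpow_le_rpow (hhol.trans ?_) hp0.le
            gcongr
            exact lintegral_mono_set hFB
        _ = (∫⁻ y in F, ω y ∂μ) * S ^ (p - 1) := by
            rw [ENNReal.mul_rpow_of_nonneg _ _ hp0.le, ← ENNReal.rpow_mul, ← ENNReal.rpow_mul,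
              one_div_mul_cancel hp0.ne', ENNReal.rpow_one]
            congr 2
            field_simp
    have hFp0 : μ F ^ p ≠ 0 := by simp [hF0, hp0.not_gt]
    have hFpT : μ F ^ p ≠ ⊤ := rpow_ne_top_of_nonneg hp0.le hFT
    have hfinal : W * μ F ^ p ≤ (A * c ^ p * ∫⁻ y in F, ω y ∂μ) * μ F ^ p := by
      calc W * μ F ^ p ≤ W * ((∫⁻ y in F, ω y ∂μ) * S ^ (p - 1)) := by gcongr
        _ = (W * S ^ (p - 1)) * ∫⁻ y in F, ω y ∂μ := by ring
        _ ≤ (A * (c * μ F) ^ p) * ∫⁻ y in F, ω y ∂μ := by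
            exact mul_le_mul' (hWS.trans (by gcongr)) le_rfl
        _ = _ := by
            rw [ENNReal.mul_rpow_of_nonneg _ _ hp0.le]
            ring
    refine ((ENNReal.mul_le_mul_iff_left hFp0 hFpT).1 hfinal).trans ?_
    gcongr
    exact le_self_add

theorem abs_setAverage_sub_le {X : Type*} [MeasurableSpace X] {μ : Measure X} {b : X → ℝ}
    {s t : Set X} (hst : s ⊆ t) (hs0 : μ s ≠ 0) (htT : μ t ≠ ⊤) (hb : IntegrableOn b t μ)
    {K : ℝ} (hK : μ.real t ≤ K * μ.real s) (c : ℝ) :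
    |(⨍ y in s, b y ∂μ) - c| ≤ K * ⨍ y in t, |b y - c| ∂μ := by
  have hsT : μ s ≠ ⊤ := ne_top_of_le_ne_top htT (measure_mono hst)
  have hs : 0 < μ.real s := ENNReal.toReal_pos hs0 hsT
  have ht : 0 < μ.real t := hs.trans_le (measureReal_mono hst htT)
  have hci : IntegrableOn (fun _ : X => c) t μ := integrableOn_const htT
  have hbc : IntegrableOn (fun y => |b y - c|) t μ := (hb.sub hci).abs
  have hnn : 0 ≤ ∫ y in t, |b y - c| ∂μ := integral_nonneg fun _ => abs_nonneg _
  have h1 : (⨍ y in s, b y ∂μ) - c = (μ.real s)⁻¹ * ∫ y in s, (b y - c) ∂μ := by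
    rw [integral_sub (hb.mono_set hst) (hci.mono_set hst), setAverage_eq, setIntegral_const,
      smul_eq_mul, smul_eq_mul, mul_sub, inv_mul_cancel_left₀ hs.ne']
  rw [h1, abs_mul, abs_of_pos (inv_pos.2 hs), setAverage_eq, smul_eq_mul]
  calc (μ.real s)⁻¹ * |∫ y in s, (b y - c) ∂μ|
      ≤ (μ.real s)⁻¹ * ∫ y in t, |b y - c| ∂μ := by
        gcongr
        exact abs_integral_le_integral_abs.trans
          (setIntegral_mono_set hbc (ae_of_all _ fun _ => abs_nonneg _) hst.eventuallyLE)
    _ ≤ (K * (μ.real t)⁻¹) * ∫ y in t, |b y - c| ∂μ := by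
        gcongr
        rw [← div_eq_mul_inv, inv_le_iff_one_le_mul₀ hs, div_mul_eq_mul_div, le_div_iff₀ ht]
        linarith
    _ = _ := by ring

theorem measure_le_two_mul_measure_abs_sub_le {X : Type*} [MeasurableSpace X] {μ : Measure X}
    {b : X → ℝ} {s : Set X} (hs0 : μ s ≠ 0) (hsT : μ s ≠ ⊤)
    (hbm : Measurable b) (hb : IntegrableOn b s μ) {c : ℝ}
    (h : ⨍ y in s, |b y - c| ∂μ ≤ 1) :
    μ s ≤ 2 * μ {y ∈ s | |b y - c| ≤ 2} := by
  have hspos : 0 < μ.real s := ENNReal.toReal_pos hs0 hsT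
  have hbc : Integrable (fun y => |b y - c|) (μ.restrict s) :=
    (hb.sub (integrableOn_const hsT : IntegrableOn (fun _ : X => c) s μ)).abs
  have hmF : MeasurableSet {y | |b y - c| ≤ 2} :=
    measurableSet_le (hbm.sub_const c).abs measurable_const
  have h1 := mul_meas_ge_le_integral_of_nonneg (ae_of_all _ fun _ => abs_nonneg _) hbc 2
  rw [setAverage_eq, smul_eq_mul, inv_mul_le_iff₀ hspos, mul_one] at h
  have h2 : (μ.restrict s).real {y | |b y - c| ≤ 2}ᶜ ≤ (μ.restrict s).real {y | 2 ≤ |b y - c|} := by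
    have : IsFiniteMeasure (μ.restrict s) := ⟨by simpa using hsT.lt_top⟩
    refine measureReal_mono fun y hy => ?_
    simp only [Set.mem_compl_iff, Set.mem_ofPred_eq, not_le] at hy ⊢
    exact hy.le
  have : IsFiniteMeasure (μ.restrict s) := ⟨by simpa using hsT.lt_top⟩
  have h3 := measureReal_add_measureReal_compl (μ := μ.restrict s) hmF
  have h4 : (μ.restrict s).real Set.univ = μ.real s := by simp [measureReal_def]
  have h5 : (μ.restrict s).real {y | |b y - c| ≤ 2} = μ.real {y ∈ s | |b y - c| ≤ 2} := by
    rw [measureReal_restrict_apply hmF, Set.inter_comm]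
    rfl
  have h6 : μ.real s ≤ 2 * μ.real {y ∈ s | |b y - c| ≤ 2} := by linarith
  have hFT : μ {y ∈ s | |b y - c| ≤ 2} ≠ ⊤ :=
    ne_top_of_le_ne_top hsT (measure_mono fun _ h => h.1)
  rw [← ENNReal.toReal_le_toReal hsT (mul_ne_top (by simp) hFT), ENNReal.toReal_mul]
  simpa [measureReal_def] using h6

theorem measureReal_ball_two_mul_le {X : Type*} [PseudoMetricSpace X] [MeasurableSpace X]
    {μ : Measure X} {K : NNReal}
    (hdoub : ∀ (x : X) (r : ℝ), μ (ball x (2 * r)) ≤ K * μ (ball x r))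
    (hball : ∀ (x : X) (r : ℝ), μ (ball x r) ≠ ⊤) (x : X) (r : ℝ) :
    μ.real (ball x (2 * r)) ≤ K * μ.real (ball x r) := by
  simpa [measureReal_def] using
    ENNReal.toReal_mono (mul_ne_top coe_ne_top (hball x r)) (hdoub x r)

section Doubling

variable {X : Type*} [MetricSpace X] [MeasurableSpace X] {μ : Measure X} {K : NNReal}

theorem ae_tendsto_setAverage_ball [BorelSpace X]
    (hdoub : ∀ (x : X) (r : ℝ), μ (ball x (2 * r)) ≤ K * μ (ball x r))
    (hpos : ∀ (x : X) (r : ℝ), 0 < r → μ (ball x r) ≠ 0)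
    (hfin : ∀ (x : X) (r : ℝ), μ (ball x r) ≠ ⊤)
    {b : X → ℝ} (hb : ∀ (x : X) (r : ℝ), IntegrableOn b (ball x r) μ) {r : ℝ} (hr : 0 < r) :
    ∀ᵐ x ∂μ, Filter.Tendsto (fun n : ℕ => ⨍ y in ball x (r / 2 ^ n), b y ∂μ) Filter.atTop
      (nhds (b x)) := by
  have : SecondCountableTopology X := secondCountableTopology_of_measure_ball hpos hfin
  have : IsLocallyFiniteMeasure μ :=
    ⟨fun x => ⟨ball x 1, ball_mem_nhds x one_pos, (hfin x 1).lt_top⟩⟩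
  have hsub : ∀ (x : X) {s : ℝ}, 0 < s → closedBall x s ⊆ ball x (2 * s) := fun x s hs =>
    closedBall_subset_ball (by linarith)
  have : IsUnifLocDoublingMeasure μ := by
    refine ⟨K * K, ?_⟩
    filter_upwards [self_mem_nhdsWithin] with s hs x
    replace hs : 0 < s := hs
    calc μ (closedBall x (2 * s)) ≤ μ (ball x (2 * (2 * s))) :=
          measure_mono (hsub x (by positivity))
      _ ≤ K * (K * μ (ball x s)) := (hdoub _ _).trans (by gcongr; exact hdoub _ _)
      _ ≤ (K * K : NNReal) * μ (closedBall x s) := by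
          rw [← mul_assoc, coe_mul]
          gcongr
          exact ball_subset_closedBall
  have hloc : LocallyIntegrable b μ := fun x => ⟨ball x 1, ball_mem_nhds x one_pos, hb x 1⟩
  have hlim : Filter.Tendsto (fun n : ℕ => r / 2 ^ n) Filter.atTop (nhdsWithin 0 (Set.Ioi 0)) := by
    refine tendsto_nhdsWithin_iff.2 ⟨?_, Filter.Eventually.of_forall fun n => ?_⟩
    · have := (tendsto_pow_atTop_nhds_zero_of_lt_one (r := (1 / 2 : ℝ)) (by norm_num)
        (by norm_num)).const_mul r
      simpa [div_eq_mul_inv] using this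
    · exact Set.mem_Ioi.2 (by positivity)
  filter_upwards [IsUnifLocDoublingMeasure.ae_tendsto_average_norm_sub μ hloc 1] with x hx
  have h1 := hx (fun _ : ℕ => x) (fun n => r / 2 ^ n) hlim
    (Filter.Eventually.of_forall fun n => mem_closedBall_self (by positivity))
  rw [tendsto_iff_norm_sub_tendsto_zero]
  refine squeeze_zero (fun _ => norm_nonneg _) (fun n => ?_)
    (by simpa using h1.const_mul (K : ℝ))
  have hrn : 0 < r / 2 ^ n := by positivity
  have hcT : μ (closedBall x (r / 2 ^ n)) ≠ ⊤ :=
    ne_top_of_le_ne_top (hfin x _) (measure_mono (hsub x hrn))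
  rw [Real.norm_eq_abs]
  exact abs_setAverage_sub_le ball_subset_closedBall (hpos x _ hrn) hcT
    ((hb x _).mono_set (hsub x hrn))
    ((measureReal_mono (hsub x hrn) (hfin x _)).trans
      (measureReal_ball_two_mul_le hdoub hfin x _)) (b x)

/-- Bisecting the radius of a ball centred at a Lebesgue point where `b` oscillates by at least `t`,
one meets a ball whose average differs from the original one by about `t`. -/
theorem exists_ball_setAverage_near
    (hdoub : ∀ (x : X) (r : ℝ), μ (ball x (2 * r)) ≤ K * μ (ball x r))
    (hpos : ∀ (x : X) (r : ℝ), 0 < r → μ (ball x r) ≠ 0)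
    (hfin : ∀ (x : X) (r : ℝ), μ (ball x r) ≠ ⊤)
    {b : X → ℝ} (hb : ∀ (x : X) (r : ℝ), IntegrableOn b (ball x r) μ)
    (hBMO : ∀ (x : X) (r : ℝ), 0 < r →
      ⨍ y in ball x r, |b y - ⨍ z in ball x r, b z ∂μ| ∂μ ≤ 1)
    {x₀ x : X} {r t : ℝ} (hr : 0 < r) (hx : x ∈ ball x₀ r)
    (hlim : Filter.Tendsto (fun n : ℕ => ⨍ y in ball x (r / 2 ^ n), b y ∂μ) Filter.atTop
      (nhds (b x)))
    (ht : (K : ℝ) ^ 2 + K + 3 ≤ t) (htx : t ≤ |b x - ⨍ z in ball x₀ r, b z ∂μ|) :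
    ∃ s : ℝ, 0 < s ∧ s ≤ r ∧
      t - 1 ≤ |(⨍ y in ball x s, b y ∂μ) - ⨍ z in ball x₀ r, b z ∂μ| ∧
      |(⨍ y in ball x s, b y ∂μ) - ⨍ z in ball x₀ r, b z ∂μ| ≤ t - 1 + K := by
  have hreal := measureReal_ball_two_mul_le hdoub hfin
  have hK : (0 : ℝ) ≤ K := K.2
  set c := ⨍ z in ball x₀ r, b z ∂μ with hc
  set a : ℕ → ℝ := fun n => |(⨍ y in ball x (r / 2 ^ n), b y ∂μ) - c| with ha
  have hex : ∃ n, t - 1 < a n := by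
    have h1 : Filter.Tendsto a Filter.atTop (nhds |b x - c|) := (hlim.sub_const c).abs
    exact (h1.eventually_const_lt (by linarith)).exists
  have h0 : a 0 ≤ (K : ℝ) ^ 2 + K := by
    have hsub1 : ball x r ⊆ ball x₀ (2 * r) := ball_subset_ball' (by
      have := mem_ball.1 hx; linarith)
    have hsub2 : ball x₀ (2 * r) ⊆ ball x (2 * (2 * r)) := ball_subset_ball' (by
      have := mem_ball'.1 hx; linarith)
    have e1 := abs_setAverage_sub_le hsub1 (hpos x r hr) (hfin x₀ _) (hb x₀ _) (K := K ^ 2)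
      (calc μ.real (ball x₀ (2 * r)) ≤ μ.real (ball x (2 * (2 * r))) :=
              measureReal_mono hsub2 (hfin _ _)
          _ ≤ K * (K * μ.real (ball x r)) :=
              (hreal _ _).trans (mul_le_mul_of_nonneg_left (hreal _ _) hK)
          _ = K ^ 2 * μ.real (ball x r) := by ring)
      (⨍ y in ball x₀ (2 * r), b y ∂μ)
    have e2 := abs_setAverage_sub_le (ball_subset_ball (by linarith : r ≤ 2 * r)) (hpos x₀ r hr)
      (hfin x₀ _) (hb x₀ _) (hreal x₀ r) (⨍ y in ball x₀ (2 * r), b y ∂μ)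
    have e3 := hBMO x₀ (2 * r) (by positivity)
    have e4 : a 0 ≤ |(⨍ y in ball x r, b y ∂μ) - ⨍ y in ball x₀ (2 * r), b y ∂μ| +
        |c - ⨍ y in ball x₀ (2 * r), b y ∂μ| := by
      rw [abs_sub_comm c]
      simpa [ha] using abs_sub_le (⨍ y in ball x r, b y ∂μ) (⨍ y in ball x₀ (2 * r), b y ∂μ) c
    nlinarith [mul_le_mul_of_nonneg_left e3 hK, mul_le_mul_of_nonneg_left e3 (sq_nonneg (K : ℝ))]
  classical
  obtain ⟨m, hm⟩ : ∃ m, Nat.find hex = m + 1 := by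
    refine Nat.exists_eq_succ_of_ne_zero fun h => ?_
    have := Nat.find_spec hex
    rw [h] at this
    linarith
  have hm1 : t - 1 < a (m + 1) := hm ▸ Nat.find_spec hex
  have hm2 : a m ≤ t - 1 := not_lt.1 (Nat.find_min hex (by omega))
  have hstep : a (m + 1) ≤ a m + K := by
    have hrm : r / 2 ^ m = 2 * (r / 2 ^ (m + 1)) := by
      rw [pow_succ]; field_simp
    have e1 := abs_setAverage_sub_le
      (ball_subset_ball (x := x) (by rw [hrm]; linarith [show 0 < r / 2 ^ (m + 1) by positivity] :
        r / 2 ^ (m + 1) ≤ r / 2 ^ m))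
      (hpos x _ (by positivity)) (hfin x _) (hb x _) (K := K) (by rw [hrm]; exact hreal _ _)
      (⨍ y in ball x (r / 2 ^ m), b y ∂μ)
    have e2 := mul_le_mul_of_nonneg_left (hBMO x (r / 2 ^ m) (by positivity)) hK
    have e3 := abs_sub_le (⨍ y in ball x (r / 2 ^ (m + 1)), b y ∂μ)
      (⨍ y in ball x (r / 2 ^ m), b y ∂μ) c
    simp only [ha]
    linarith
  exact ⟨r / 2 ^ (m + 1), by positivity, div_le_self hr.le (one_le_pow₀ one_le_two), hm1.le,
    by change a (m + 1) ≤ _; linarith⟩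

/-- The superlevel set of the oscillation of `b` on a ball is controlled by a layer of bounded
width of the same oscillation on the double ball. -/
theorem measure_le_abs_sub_setAverage_le [BorelSpace X]
    (hdoub : ∀ (x : X) (r : ℝ), μ (ball x (2 * r)) ≤ K * μ (ball x r))
    (hpos : ∀ (x : X) (r : ℝ), 0 < r → μ (ball x r) ≠ 0)
    (hfin : ∀ (x : X) (r : ℝ), μ (ball x r) ≠ ⊤)
    {ν : Measure X} (hν : ν ≪ μ) {D : ℝ≥0∞}
    (hD : ∀ (x : X) (r : ℝ), 0 < r → ∀ F : Set X, MeasurableSet F → F ⊆ ball x r →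
      μ (ball x r) ≤ (2 * K ^ 3 : NNReal) * μ F → ν (ball x r) ≤ D * ν F)
    {b : X → ℝ} (hbm : Measurable b) (hb : ∀ (x : X) (r : ℝ), IntegrableOn b (ball x r) μ)
    (hBMO : ∀ (x : X) (r : ℝ), 0 < r →
      ⨍ y in ball x r, |b y - ⨍ z in ball x r, b z ∂μ| ∂μ ≤ 1)
    {x₀ : X} {r t L : ℝ} (hr : 0 < r) (hL : (K : ℝ) ^ 2 + K + 3 ≤ L) (ht : L ≤ t) :
    ν {x ∈ ball x₀ r | t ≤ |b x - ⨍ z in ball x₀ r, b z ∂μ|} ≤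
      D * ν {x ∈ ball x₀ (2 * r) | t - L ≤ |b x - ⨍ z in ball x₀ r, b z ∂μ| ∧
        |b x - ⨍ z in ball x₀ r, b z ∂μ| ≤ t + L} := by
  have : SecondCountableTopology X := secondCountableTopology_of_measure_ball hpos hfin
  have hK : (0 : ℝ) ≤ K := K.2
  have hKK : (K : ℝ) + 1 ≤ L := by nlinarith [sq_nonneg (K : ℝ)]
  have hL3 : 3 ≤ L := by nlinarith [sq_nonneg (K : ℝ)]
  set c := ⨍ z in ball x₀ r, b z ∂μ with hc
  set E := {x ∈ ball x₀ r | t ≤ |b x - c|} with hE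
  set G := {x | Filter.Tendsto (fun n : ℕ => ⨍ y in ball x (r / 2 ^ n), b y ∂μ) Filter.atTop
      (nhds (b x))} with hG
  have hGc : ν Gᶜ = 0 := hν (ae_tendsto_setAverage_ball hdoub hpos hfin hb hr)
  have hradius : ∀ x : X, ∃ s : ℝ, x ∈ E ∩ G → 0 < s ∧ s ≤ r ∧
      t - 1 ≤ |(⨍ y in ball x s, b y ∂μ) - c| ∧
      |(⨍ y in ball x s, b y ∂μ) - c| ≤ t - 1 + K := by
    intro x
    by_cases hx : x ∈ E ∩ G
    · obtain ⟨s, hs⟩ := exists_ball_setAverage_near hdoub hpos hfin hb hBMO hr hx.1.1 hx.2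
        (hL.trans ht) hx.1.2
      exact ⟨s, fun _ => hs⟩
    · exact ⟨0, fun h => absurd h hx⟩
  choose s hs using hradius
  obtain ⟨u, hu, hdisj, hcov⟩ := Vitali.exists_disjoint_subfamily_covering_enlargement_closedBall
    (E ∩ G) id s r (fun x hx => (hs x hx).2.1) 5 (by norm_num)
  have hdisj' : u.PairwiseDisjoint fun x => ball x (s x) :=
    hdisj.mono fun x => ball_subset_closedBall
  have hcount : u.Countable := hdisj'.countable_of_isOpen (fun _ _ => isOpen_ball)
    fun x hx => nonempty_ball.2 (hs x (hu hx)).1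
  set F : X → Set X := fun x =>
    {y ∈ ball x (s x) | |b y - ⨍ z in ball x (s x), b z ∂μ| ≤ 2} with hF
  have hFm : ∀ x, MeasurableSet (F x) := fun x =>
    measurableSet_ball.inter (measurableSet_le (hbm.sub_const _).abs measurable_const)
  have hcover : E ∩ G ⊆ ⋃ x ∈ u, ball x (2 * (2 * (2 * s x))) := by
    intro x hx
    obtain ⟨y, hy, hxy⟩ := hcov x hx
    have hsy := (hs y (hu hy)).1
    exact Set.mem_biUnion hy (closedBall_subset_ball (by linarith)
      (hxy (mem_closedBall_self (hs x hx).1.le)))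
  have hballs : ∀ x ∈ u, ν (ball x (2 * (2 * (2 * s x)))) ≤ D * ν (F x) := by
    intro x hx
    have hsx := (hs x (hu hx)).1
    refine hD x _ (by positivity) (F x) (hFm x)
      (fun y hy => ball_subset_ball (by linarith) hy.1) ?_
    have h2 := measure_le_two_mul_measure_abs_sub_le (hpos x _ hsx) (hfin x _)
      hbm (hb x _) (hBMO x _ hsx)
    calc μ (ball x (2 * (2 * (2 * s x)))) ≤ K * (K * (K * μ (ball x (s x)))) := by
          refine (hdoub _ _).trans ?_
          gcongr
          refine (hdoub _ _).trans ?_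
          gcongr
          exact hdoub _ _
      _ ≤ K * (K * (K * (2 * μ (F x)))) := by gcongr
      _ = _ := by push_cast; ring
  calc ν E ≤ ν ((⋃ x ∈ u, ball x (2 * (2 * (2 * s x)))) ∪ Gᶜ) := by
        refine measure_mono fun x hx => ?_
        by_cases hxG : x ∈ G
        · exact Or.inl (hcover ⟨hx, hxG⟩)
        · exact Or.inr hxG
    _ ≤ ν (⋃ x ∈ u, ball x (2 * (2 * (2 * s x)))) + ν Gᶜ := measure_union_le _ _
    _ = ν (⋃ x ∈ u, ball x (2 * (2 * (2 * s x)))) := by rw [hGc, add_zero]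
    _ ≤ ∑' x : u, ν (ball (x : X) (2 * (2 * (2 * s x)))) := measure_biUnion_le _ hcount _
    _ ≤ ∑' x : u, D * ν (F x) := ENNReal.tsum_le_tsum fun x => hballs x x.2
    _ = D * ∑' x : u, ν (F x) := ENNReal.tsum_mul_left
    _ = D * ν (⋃ x ∈ u, F x) := by
        rw [measure_biUnion hcount (hdisj'.mono fun x y hy => hy.1) fun x _ => hFm x]
    _ ≤ _ := by
        gcongr
        refine Set.iUnion₂_subset fun x hx y hy => ?_
        obtain ⟨h1, h2, h3, h4⟩ := hs x (hu hx)
        have hxE := (hu hx).1.1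
        refine ⟨ball_subset_ball' ?_ hy.1, ?_, ?_⟩
        · have := mem_ball.1 hxE
          linarith
        · have := abs_sub_le (⨍ z in ball x (s x), b z ∂μ) (b y) c
          have h5 := hy.2
          rw [abs_sub_comm] at h5
          linarith
        · have := abs_sub_le (b y) (⨍ z in ball x (s x), b z ∂μ) c
          have h5 := hy.2
          linarith

end Doubling

theorem Nat.succ_pow_succ_le_mul_sum (k n : ℕ) :
    (n + 1) ^ (k + 1) ≤ (k + 1) * ∑ j ∈ Finset.range (n + 1), (j + 1) ^ k := by
  have hdiff : ∀ a k : ℕ, (a + 1) ^ (k + 1) ≤ a ^ (k + 1) + (k + 1) * (a + 1) ^ k := by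
    intro a k
    induction k with
    | zero => simp
    | succ k ih =>
      calc (a + 1) ^ (k + 1 + 1) = (a + 1) ^ (k + 1) * a + (a + 1) ^ (k + 1) := by ring
        _ ≤ (a ^ (k + 1) + (k + 1) * (a + 1) ^ k) * a + (a + 1) ^ (k + 1) := by gcongr
        _ = a ^ (k + 2) + (k + 1) * ((a + 1) ^ k * a) + (a + 1) ^ (k + 1) := by ring
        _ ≤ a ^ (k + 2) + (k + 1) * ((a + 1) ^ k * (a + 1)) + (a + 1) ^ (k + 1) := by
            gcongr
            omega
        _ = _ := by ring
  induction n with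
  | zero => simp
  | succ n ih =>
    rw [Finset.sum_range_succ, mul_add]
    exact (hdiff (n + 1) k).trans (by gcongr)

theorem setLIntegral_succ_pow_succ_le {X : Type*} [MeasurableSpace X] {ν : Measure X}
    {n : X → ℕ} (hn : Measurable n) {s t : Set X} {D : ℝ≥0∞}
    (h : ∀ j : ℕ, 1 ≤ j → ν {x ∈ s | j ≤ n x} ≤ D * ν {x ∈ t | n x ≤ j + 1 ∧ j ≤ n x + 1})
    (k : ℕ) :
    ∫⁻ x in s, ((n x : ℝ≥0∞) + 1) ^ (k + 1) ∂ν ≤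
      (k + 1) * (ν s + 3 * D * ∫⁻ x in t, ((n x : ℝ≥0∞) + 2) ^ k ∂ν) := by
  have hm1 : ∀ j : ℕ, MeasurableSet {x | j ≤ n x} := fun j => hn (measurableSet_Ici (a := j))
  have hm2 : ∀ j : ℕ, MeasurableSet {x | n x ≤ j + 1 ∧ j ≤ n x + 1} := fun j =>
    (measurableSet_le hn measurable_const).inter
      (measurableSet_le measurable_const (hn.add_const 1))
  have hpt : ∀ x, ((n x : ℝ≥0∞) + 1) ^ (k + 1) ≤
      (k + 1) * ∑' j : ℕ, {x | j ≤ n x}.indicator (fun _ => ((j : ℝ≥0∞) + 1) ^ k) x := by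
    intro x
    have h1 := Nat.succ_pow_succ_le_mul_sum k (n x)
    have h2 : ((n x : ℝ≥0∞) + 1) ^ (k + 1) ≤
        (k + 1) * ∑ j ∈ Finset.range (n x + 1), ((j : ℝ≥0∞) + 1) ^ k := by exact_mod_cast h1
    refine h2.trans ?_
    gcongr
    refine le_trans (Finset.sum_le_sum fun j hj => ?_) (ENNReal.sum_le_tsum _)
    rw [Set.indicator_of_mem (show x ∈ {x | j ≤ n x} by
      simpa [Nat.lt_succ_iff] using hj)]
  have hpt2 : ∀ x, ∑' j : ℕ, {x | n x ≤ j + 1 ∧ j ≤ n x + 1}.indicator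
      (fun _ => ((j : ℝ≥0∞) + 1) ^ k) x ≤ 3 * ((n x : ℝ≥0∞) + 2) ^ k := by
    intro x
    rw [tsum_eq_sum (s := Finset.Icc (n x - 1) (n x + 1))]
    · refine (Finset.sum_le_card_nsmul _ _ (((n x : ℝ≥0∞) + 2) ^ k) fun j hj => ?_).trans ?_
      · refine (Set.indicator_le_self' (fun _ _ => zero_le) x).trans ?_
        have : j + 1 ≤ n x + 2 := by have := (Finset.mem_Icc.1 hj).2; omega
        have h2 : (j : ℝ≥0∞) + 1 ≤ (n x : ℝ≥0∞) + 2 := by exact_mod_cast this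
        gcongr
      · rw [nsmul_eq_mul]
        gcongr
        have : (Finset.Icc (n x - 1) (n x + 1)).card ≤ 3 := by
          rw [Nat.card_Icc]; omega
        exact_mod_cast this
    · intro j hj
      refine Set.indicator_of_notMem (fun hx => hj ?_) _
      simp only [Set.mem_ofPred_eq] at hx
      exact Finset.mem_Icc.2 ⟨by omega, hx.2⟩
  have htsum_left : ∫⁻ x in s, ∑' j : ℕ, {x | j ≤ n x}.indicator (fun _ => ((j : ℝ≥0∞) + 1) ^ k) x ∂ν =
      ∑' j : ℕ, ((j : ℝ≥0∞) + 1) ^ k * ν {x ∈ s | j ≤ n x} := by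
    rw [lintegral_tsum fun j => (measurable_const.indicator (hm1 j)).aemeasurable]
    refine tsum_congr fun j => ?_
    rw [lintegral_indicator_const (hm1 j), Measure.restrict_apply (hm1 j), Set.inter_comm]
    rfl
  have htsum_right : ∫⁻ x in t, ∑' j : ℕ, {x | n x ≤ j + 1 ∧ j ≤ n x + 1}.indicator
      (fun _ => ((j : ℝ≥0∞) + 1) ^ k) x ∂ν =
      ∑' j : ℕ, ((j : ℝ≥0∞) + 1) ^ k * ν {x ∈ t | n x ≤ j + 1 ∧ j ≤ n x + 1} := by
    rw [lintegral_tsum fun j => (measurable_const.indicator (hm2 j)).aemeasurable]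
    refine tsum_congr fun j => ?_
    rw [lintegral_indicator_const (hm2 j), Measure.restrict_apply (hm2 j), Set.inter_comm]
    rfl
  calc ∫⁻ x in s, ((n x : ℝ≥0∞) + 1) ^ (k + 1) ∂ν
      ≤ ∫⁻ x in s, (k + 1) *
          ∑' j : ℕ, {x | j ≤ n x}.indicator (fun _ => ((j : ℝ≥0∞) + 1) ^ k) x ∂ν :=
        lintegral_mono hpt
    _ = (k + 1) * ∑' j : ℕ, ((j : ℝ≥0∞) + 1) ^ k * ν {x ∈ s | j ≤ n x} := by
        rw [lintegral_const_mul' _ _ (by simp), htsum_left]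
    _ ≤ (k + 1) * ∑' j : ℕ, ((if j = 0 then ν s else 0) +
          D * (((j : ℝ≥0∞) + 1) ^ k * ν {x ∈ t | n x ≤ j + 1 ∧ j ≤ n x + 1})) := by
        gcongr with j
        rcases Nat.eq_zero_or_pos j with rfl | hj
        · simp
        · rw [if_neg hj.ne', zero_add, mul_left_comm]
          gcongr
          exact h j hj
    _ = (k + 1) * (ν s + D * ∫⁻ x in t, ∑' j : ℕ, {x | n x ≤ j + 1 ∧ j ≤ n x + 1}.indicator
          (fun _ => ((j : ℝ≥0∞) + 1) ^ k) x ∂ν) := by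
        rw [ENNReal.tsum_add, tsum_ite_eq, ENNReal.tsum_mul_left, htsum_right]
    _ ≤ (k + 1) * (ν s + D * ∫⁻ x in t, 3 * ((n x : ℝ≥0∞) + 2) ^ k ∂ν) := by
        gcongr with x
        exact hpt2 x
    _ = _ := by
        rw [lintegral_const_mul' _ _ (by simp)]
        ring

theorem exists_setLIntegral_abs_sub_setAverage_pow_le {X : Type*} [MetricSpace X]
    [MeasurableSpace X] [BorelSpace X] {μ : Measure X} {K : NNReal}
    (hdoub : ∀ (x : X) (r : ℝ), μ (ball x (2 * r)) ≤ K * μ (ball x r))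
    (hpos : ∀ (x : X) (r : ℝ), 0 < r → μ (ball x r) ≠ 0)
    (hfin : ∀ (x : X) (r : ℝ), μ (ball x r) ≠ ⊤)
    {ν : Measure X} (hν : ν ≪ μ)
    (hA : ∀ c : ℝ≥0∞, c ≠ ⊤ → ∃ D : ℝ≥0∞, D ≠ ⊤ ∧ ∀ (x : X) (r : ℝ), 0 < r →
      ∀ F : Set X, MeasurableSet F → F ⊆ ball x r → μ (ball x r) ≤ c * μ F →
      ν (ball x r) ≤ D * ν F)
    {b : X → ℝ} (hbm : Measurable b) (hb : ∀ (x : X) (r : ℝ), IntegrableOn b (ball x r) μ)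
    (hBMO : ∀ (x : X) (r : ℝ), 0 < r →
      ⨍ y in ball x r, |b y - ⨍ z in ball x r, b z ∂μ| ∂μ ≤ 1) (k : ℕ) :
    ∀ a : ℝ, 0 ≤ a → ∃ C : ℝ≥0∞, C ≠ ⊤ ∧ ∀ (x : X) (r : ℝ), 0 < r →
      ∫⁻ y in ball x r, ENNReal.ofReal (|b y - ⨍ z in ball x r, b z ∂μ| + a) ^ k ∂ν ≤
        C * ν (ball x r) := by
  induction k with
  | zero => exact fun a _ => ⟨1, one_ne_top, fun x r _ => by simp⟩
  | succ k ih =>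
    intro a ha
    have hK : (0 : ℝ) ≤ K := K.2
    obtain ⟨D, hDT, hD⟩ := hA (2 * K ^ 3 : NNReal) coe_ne_top
    obtain ⟨D', hDT', hD'⟩ := hA K coe_ne_top
    obtain ⟨C, hCT, hC⟩ := ih (K + 2) (by positivity)
    set L : ℝ := K ^ 2 + K + 3 with hLdef
    have hL1 : 1 ≤ L := by nlinarith [sq_nonneg (K : ℝ)]
    have hL0 : 0 < L := by linarith
    refine ⟨ENNReal.ofReal (L + a) ^ (k + 1) * ((k + 1) * (1 + 3 * D * (C * D'))), ?_, ?_⟩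
    · finiteness
    intro x r hr
    set c := ⨍ z in ball x r, b z ∂μ with hc
    set c' := ⨍ z in ball x (2 * r), b z ∂μ with hc'
    set n : X → ℕ := fun y => ⌊|b y - c| / L⌋₊ with hn
    have hnm : Measurable n := Nat.measurable_floor.comp ((hbm.sub_const c).abs.div_const L)
    have hcc : |c - c'| ≤ K := by
      have e1 := abs_setAverage_sub_le (ball_subset_ball (by linarith : r ≤ 2 * r)) (hpos x r hr)
        (hfin x _) (hb x _) (measureReal_ball_two_mul_le hdoub hfin x r) c'
      have e2 := mul_le_mul_of_nonneg_left (hBMO x (2 * r) (by positivity)) hK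
      linarith
    have hlevel : ∀ j : ℕ, 1 ≤ j → ν {y ∈ ball x r | j ≤ n y} ≤
        D * ν {y ∈ ball x (2 * r) | n y ≤ j + 1 ∧ j ≤ n y + 1} := by
      intro j hj
      have hj' : (1 : ℝ) ≤ j := by exact_mod_cast hj
      have h1 := measure_le_abs_sub_setAverage_le hdoub hpos hfin hν hD hbm hb hBMO (x₀ := x)
        (t := j * L) hr le_rfl (by nlinarith)
      refine (measure_mono ?_).trans (h1.trans ?_)
      · rintro y ⟨hy, hjy⟩
        refine ⟨hy, ?_⟩
        have := (Nat.le_floor_iff (by positivity)).1 hjy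
        exact (le_div_iff₀ hL0).1 this
      · refine mul_le_mul' le_rfl (measure_mono ?_)
        rintro y ⟨hy, h2, h3⟩
        refine ⟨hy, ?_, ?_⟩
        · refine Nat.floor_le_of_le ?_
          rw [div_le_iff₀ hL0]
          push_cast
          linarith
        · have h4 := Nat.lt_floor_add_one (|b y - c| / L)
          rw [div_lt_iff₀ hL0] at h4
          have h5 : (j : ℝ) - 1 < n y + 1 := by
            refine lt_of_mul_lt_mul_right ?_ hL0.le
            change _ < ((⌊|b y - c| / L⌋₊ : ℝ) + 1) * L
            linarith
          have h6 : (j : ℝ) < ((n y + 2 : ℕ) : ℝ) := by push_cast; linarith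
          have h7 : j < n y + 2 := by exact_mod_cast h6
          omega
    have hmain := setLIntegral_succ_pow_succ_le hnm hlevel k
    have hupper : ∀ y, ENNReal.ofReal (|b y - c| + a) ≤
        ENNReal.ofReal (L + a) * ((n y : ℝ≥0∞) + 1) := by
      intro y
      have h4 := Nat.lt_floor_add_one (|b y - c| / L)
      rw [div_lt_iff₀ hL0] at h4
      have e : ((n y : ℝ≥0∞) + 1) = ENNReal.ofReal (n y + 1) := by
        rw [ENNReal.ofReal_add (by positivity) zero_le_one, ENNReal.ofReal_natCast,
          ENNReal.ofReal_one]
      rw [e, ← ENNReal.ofReal_mul (by positivity)]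
      refine ENNReal.ofReal_le_ofReal ?_
      have h8 : 0 ≤ a * (n y : ℝ) := by positivity
      have h9 : |b y - c| < ((n y : ℝ) + 1) * L := h4
      nlinarith
    have hlower : ∀ y, (n y : ℝ≥0∞) + 2 ≤ ENNReal.ofReal (|b y - c'| + (K + 2)) := by
      intro y
      have e : ((n y : ℝ≥0∞) + 2) = ENNReal.ofReal (n y + 2) := by
        rw [ENNReal.ofReal_add (by positivity) zero_le_two, ENNReal.ofReal_natCast,
          ENNReal.ofReal_ofNat]
      rw [e]
      refine ENNReal.ofReal_le_ofReal ?_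
      have h1 : (n y : ℝ) ≤ |b y - c| / L := Nat.floor_le (by positivity)
      have h2 : |b y - c| / L ≤ |b y - c| := div_le_self (abs_nonneg _) hL1
      have h3 := abs_sub_le (b y) c' c
      rw [abs_sub_comm c'] at h3
      linarith
    have hdν : ν (ball x (2 * r)) ≤ D' * ν (ball x r) :=
      hD' x (2 * r) (by positivity) _ measurableSet_ball (ball_subset_ball (by linarith))
        (hdoub x r)
    calc ∫⁻ y in ball x r, ENNReal.ofReal (|b y - c| + a) ^ (k + 1) ∂ν
        ≤ ∫⁻ y in ball x r, ENNReal.ofReal (L + a) ^ (k + 1) * ((n y : ℝ≥0∞) + 1) ^ (k + 1) ∂ν := by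
          refine lintegral_mono fun y => ?_
          rw [← mul_pow]
          exact pow_le_pow_left' (hupper y) _
      _ = ENNReal.ofReal (L + a) ^ (k + 1) *
            ∫⁻ y in ball x r, ((n y : ℝ≥0∞) + 1) ^ (k + 1) ∂ν :=
          lintegral_const_mul' _ _ (by finiteness)
      _ ≤ ENNReal.ofReal (L + a) ^ (k + 1) * ((k + 1) * (ν (ball x r) +
            3 * D * ∫⁻ y in ball x (2 * r), ENNReal.ofReal (|b y - c'| + (K + 2)) ^ k ∂ν)) := by
          gcongr
          refine hmain.trans ?_
          gcongr with y
          exact hlower y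
      _ ≤ ENNReal.ofReal (L + a) ^ (k + 1) * ((k + 1) * (ν (ball x r) +
            3 * D * (C * (D' * ν (ball x r))))) := by
          gcongr
          refine (hC x (2 * r) (by positivity)).trans ?_
          gcongr
      _ = _ := by ring

theorem exists_setLIntegral_abs_sub_setAverage_rpow_le {X : Type*} [MetricSpace X]
    [MeasurableSpace X] [BorelSpace X] {μ : Measure X} {K : NNReal}
    (hdoub : ∀ (x : X) (r : ℝ), μ (ball x (2 * r)) ≤ K * μ (ball x r))
    (hpos : ∀ (x : X) (r : ℝ), 0 < r → μ (ball x r) ≠ 0)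
    (hfin : ∀ (x : X) (r : ℝ), μ (ball x r) ≠ ⊤)
    {p : ℝ} (hp : 1 ≤ p) {ω : X → ℝ≥0∞} (hωm : Measurable ω) (hAp : IsAp μ ω p)
    {b : X → ℝ} (hb : ∀ (x : X) (r : ℝ), IntegrableOn b (ball x r) μ)
    (hBMO : ∀ (x : X) (r : ℝ), 0 < r →
      ⨍ y in ball x r, |b y - ⨍ z in ball x r, b z ∂μ| ∂μ ≤ 1) :
    ∃ C : ℝ≥0∞, C ≠ ⊤ ∧ ∀ (x : X) (r : ℝ), 0 < r →
      ∫⁻ y in ball x r, ENNReal.ofReal (|b y - ⨍ z in ball x r, b z ∂μ| ^ p) * ω y ∂μ ≤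
        C * ∫⁻ y in ball x r, ω y ∂μ := by
  rcases isEmpty_or_nonempty X with hX | ⟨⟨x₀⟩⟩
  · exact ⟨0, zero_ne_top, fun x => (IsEmpty.false x).elim⟩
  have hbmeas : AEMeasurable b μ := by
    rw [← Measure.restrict_univ (μ := μ), ← iUnion_ball_nat x₀]
    exact aemeasurable_iUnion_iff.2 fun n => (hb x₀ n).aemeasurable
  set b' := hbmeas.mk b with hb'
  have hbb : b =ᵐ[μ] b' := hbmeas.ae_eq_mk
  have hbr : ∀ s : Set X, b =ᵐ[μ.restrict s] b' := fun s => ae_restrict_of_ae hbb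
  have havg : ∀ s : Set X, ⨍ z in s, b z ∂μ = ⨍ z in s, b' z ∂μ := fun s =>
    average_congr (hbr s)
  have hb'int : ∀ (x : X) (r : ℝ), IntegrableOn b' (ball x r) μ := fun x r =>
    (hb x r).congr (hbr _)
  have hb'BMO : ∀ (x : X) (r : ℝ), 0 < r →
      ⨍ y in ball x r, |b' y - ⨍ z in ball x r, b' z ∂μ| ∂μ ≤ 1 := by
    intro x r hr
    refine le_of_eq_of_le (average_congr ?_) (hBMO x r hr)
    filter_upwards [hbr (ball x r)] with y hy
    rw [hy, havg]
  obtain ⟨C, hCT, hC⟩ := exists_setLIntegral_abs_sub_setAverage_pow_le hdoub hpos hfin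
    (withDensity_absolutelyContinuous μ ω)
    (hAp.withDensity_ball_le (fun x r hr => ⟨hpos x r hr, hfin x r⟩) hp hωm)
    hbmeas.measurable_mk hb'int hb'BMO ⌈p⌉₊ 1 zero_le_one
  refine ⟨C, hCT, fun x r hr => ?_⟩
  have h := hC x r hr
  have hm : Measurable fun y =>
      ENNReal.ofReal (|b' y - ⨍ z in ball x r, b' z ∂μ| + 1) ^ ⌈p⌉₊ :=
    ((hbmeas.measurable_mk.sub_const _).abs.add_const 1).ennreal_ofReal.pow_const _
  rw [setLIntegral_withDensity_eq_setLIntegral_mul μ hωm hm measurableSet_ball,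
    withDensity_apply _ measurableSet_ball] at h
  refine le_trans (lintegral_mono_ae ?_) h
  filter_upwards [hbr (ball x r)] with y hy
  rw [hy, havg, Pi.mul_apply, mul_comm]
  gcongr
  rw [← ENNReal.ofReal_pow (by positivity)]
  refine ENNReal.ofReal_le_ofReal ?_
  set f := |b' y - ⨍ z in ball x r, b' z ∂μ| with hf
  have hf0 : 0 ≤ f := abs_nonneg _
  calc f ^ p ≤ (f + 1) ^ p := Real.rpow_le_rpow hf0 (by linarith) (by linarith)
    _ ≤ (f + 1) ^ (⌈p⌉₊ : ℝ) := Real.rpow_le_rpow_of_exponent_le (by linarith) (Nat.le_ceil p)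
    _ = (f + 1) ^ ⌈p⌉₊ := Real.rpow_natCast _ _

/-- Lemma 2.4 (2): weighted John–Nirenberg type estimate:
`(∫_B |b − b_B|^p ω dμ)^{1/p} ≤ C ‖b‖_{BMO} ω(B)^{1/p}` for `ω ∈ A_p(μ)`, `p ∈ [1,∞)`. -/
theorem stmt9 {X : Type*} [MetricSpace X] [MeasurableSpace X] [BorelSpace X]
    (μ : Measure X) (Cμ : ℝ≥0∞) (hCμ : Cμ ≠ ⊤)
    (hdoub : ∀ (x : X) (r : ℝ), μ (ball x (2 * r)) ≤ Cμ * μ (ball x r))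
    (hball : ∀ (x : X) (r : ℝ), 0 < r → μ (ball x r) ≠ 0 ∧ μ (ball x r) ≠ ⊤)
    (p : ℝ) (hp : 1 ≤ p)
    (ω : X → ℝ≥0∞) (hωm : Measurable ω) (hAp : IsAp μ ω p)
    (b : X → ℝ) (hbint : ∀ (x : X) (r : ℝ), IntegrableOn b (ball x r) μ)
    (N : ℝ)
    (hBMO : ∀ (x : X) (r : ℝ), 0 < r →
      ⨍ y in ball x r, |b y - ⨍ z in ball x r, b z ∂μ| ∂μ ≤ N) :
    ∃ C : ℝ, 0 < C ∧ ∀ (x : X) (r : ℝ), 0 < r →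
      (∫⁻ y in ball x r,
          ENNReal.ofReal (|b y - ⨍ z in ball x r, b z ∂μ| ^ p) * ω y ∂μ) ^ (1 / p) ≤
        ENNReal.ofReal (C * N) * (∫⁻ y in ball x r, ω y ∂μ) ^ (1 / p) := by
  have hpos : ∀ (x : X) (r : ℝ), 0 < r → μ (ball x r) ≠ 0 := fun x r hr => (hball x r hr).1
  have hfin : ∀ (x : X) (r : ℝ), μ (ball x r) ≠ ⊤ := by
    intro x r
    rcases le_or_gt r 0 with hr | hr
    · simp [ball_eq_empty.2 hr]
    · exact (hball x r hr).2
  have hp0 : 0 < p := by linarith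
  lift Cμ to NNReal using hCμ
  rcases le_or_gt N 0 with hN | hN
  · refine ⟨1, one_pos, fun x r hr => ?_⟩
    set c := ⨍ z in ball x r, b z ∂μ with hc
    have h_integral : Integrable (fun y => |b y - c|) (μ.restrict (ball x r)) :=
      ((hbint x r).sub (integrableOn_const (hfin x r) :
        IntegrableOn (fun _ : X => c) (ball x r) μ)).abs
    have h0 : ∫ y in ball x r, |b y - c| ∂μ = 0 := by
      have h := (hBMO x r hr).trans hN
      have hm : 0 < μ.real (ball x r) := ENNReal.toReal_pos (hpos x r hr) (hfin x r)
      rw [setAverage_eq, smul_eq_mul, inv_mul_le_iff₀ hm, mul_zero] at h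
      exact le_antisymm h (integral_nonneg fun _ => abs_nonneg _)
    have hae := (integral_eq_zero_iff_of_nonneg (fun _ => abs_nonneg _) h_integral).1 h0
    have hz : ∫⁻ y in ball x r, ENNReal.ofReal (|b y - c| ^ p) * ω y ∂μ = 0 := by
      rw [lintegral_congr_ae (g := fun _ => 0), lintegral_zero]
      filter_upwards [hae] with y hy
      have hy' : |b y - c| = 0 := hy
      rw [hy', Real.zero_rpow hp0.ne', ENNReal.ofReal_zero, zero_mul]
    rw [hz, ENNReal.zero_rpow_of_pos (by positivity)]
    exact zero_le
  have havg : ∀ s : Set X, ⨍ z in s, N⁻¹ * b z ∂μ = N⁻¹ * ⨍ z in s, b z ∂μ := fun s => by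
    rw [setAverage_eq, setAverage_eq, integral_const_mul, smul_eq_mul, smul_eq_mul, mul_left_comm]
  have hosc : ∀ (s : Set X) (y : X), |N⁻¹ * b y - ⨍ z in s, N⁻¹ * b z ∂μ| =
      N⁻¹ * |b y - ⨍ z in s, b z ∂μ| := fun s y => by
    rw [havg, ← mul_sub, abs_mul, abs_of_pos (inv_pos.2 hN)]
  obtain ⟨C, hCT, hC⟩ := exists_setLIntegral_abs_sub_setAverage_rpow_le hdoub hpos hfin hp hωm hAp
    (b := fun y => N⁻¹ * b y) (fun x r => (hbint x r).const_mul _) (by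
      intro x r hr
      simp only [hosc]
      rw [setAverage_eq, integral_const_mul, smul_eq_mul, mul_left_comm, ← smul_eq_mul (μ.real _)⁻¹,
        ← setAverage_eq, inv_mul_le_iff₀ hN, mul_one]
      exact hBMO x r hr)
  have hC1T : (C + 1) ^ (1 / p) ≠ ⊤ :=
    rpow_ne_top_of_nonneg (by positivity) (add_ne_top.2 ⟨hCT, one_ne_top⟩)
  have hC1 : (C + 1) ^ (1 / p) ≠ 0 := by
    simp [hp0.le]
  refine ⟨((C + 1) ^ (1 / p)).toReal, ENNReal.toReal_pos hC1 hC1T, fun x r hr => ?_⟩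
  have hscale : ∀ y, ENNReal.ofReal (|b y - ⨍ z in ball x r, b z ∂μ| ^ p) =
      ENNReal.ofReal N ^ p *
        ENNReal.ofReal (|N⁻¹ * b y - ⨍ z in ball x r, N⁻¹ * b z ∂μ| ^ p) := fun y => by
    rw [hosc, ENNReal.ofReal_rpow_of_nonneg hN.le hp0.le, ← ENNReal.ofReal_mul (by positivity),
      ← Real.mul_rpow hN.le (by positivity), mul_inv_cancel_left₀ hN.ne']
  have hNT : ENNReal.ofReal N ^ p ≠ ⊤ := rpow_ne_top_of_nonneg hp0.le ofReal_ne_top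
  calc (∫⁻ y in ball x r, ENNReal.ofReal (|b y - ⨍ z in ball x r, b z ∂μ| ^ p) * ω y ∂μ) ^ (1 / p)
      = (ENNReal.ofReal N ^ p * ∫⁻ y in ball x r,
          ENNReal.ofReal (|N⁻¹ * b y - ⨍ z in ball x r, N⁻¹ * b z ∂μ| ^ p) * ω y ∂μ) ^ (1 / p) := by
        simp only [hscale, mul_assoc]
        rw [lintegral_const_mul' _ _ hNT]
    _ ≤ (ENNReal.ofReal N ^ p * ((C + 1) * ∫⁻ y in ball x r, ω y ∂μ)) ^ (1 / p) := by
        gcongr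
        refine (hC x r hr).trans ?_
        gcongr
        exact le_self_add
    _ = _ := by
        have h1p : 0 ≤ 1 / p := by positivity
        rw [ENNReal.mul_rpow_of_nonneg _ _ h1p, ENNReal.mul_rpow_of_nonneg _ _ h1p,
          ← ENNReal.rpow_mul, mul_one_div_cancel hp0.ne', ENNReal.rpow_one,
          ENNReal.ofReal_mul ENNReal.toReal_nonneg, ENNReal.ofReal_toReal hC1T]
        ring
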